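/- arXiv:1910.03917 — 2 statements merged into one kernel-verified Lean document; each statement's English description precedes it below -/
import Mathlib

section
/- If a clause set R(η) is refuted by a clause set cycle S(η) with offset i and step j (where i ≥ 0, j ≥ 1), then R(η) is refuted by a clause set cycle (with offset 0 and step 1); explicitly, the clause set U(η) := ⋁_{l=0}^{j−1} S(s^{i+l}(η)) is a clause set cycle refuting R(η). -/
open FirstOrder Language Structure

universe u v w u'

namespace ClauseSetCycles

variable {L : FirstOrder.Language.{u, v}}

/-- A literal is an atomic formula or the negation of an atomic formula. -/
inductive IsLiteral {α : Type u'} : ∀ {n : ℕ}, L.BoundedFormula α n → Prop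
  | atom {n} {φ : L.BoundedFormula α n} : φ.IsAtomic → IsLiteral φ
  | negAtom {n} {φ : L.BoundedFormula α n} : φ.IsAtomic → IsLiteral φ.not

/-- A disjunction of literals (identifying, as usual, a formula such as
`a₁ → (b₁ ∨ b₂)` with its negation normal form `¬a₁ ∨ b₁ ∨ b₂`). -/
inductive IsClauseMatrix {α : Type u'} : ∀ {n : ℕ}, L.BoundedFormula α n → Prop
  | lit {n} {φ : L.BoundedFormula α n} : IsLiteral φ → IsClauseMatrix φ
  | sup {n} {φ ψ : L.BoundedFormula α n} :
      IsClauseMatrix φ → IsClauseMatrix ψ → IsClauseMatrix (φ ⊔ ψ)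
  | impAtom {n} {φ ψ : L.BoundedFormula α n} :
      φ.IsAtomic → IsClauseMatrix ψ → IsClauseMatrix (φ.imp ψ)

/-- A clause is a universally quantified disjunction of literals. -/
inductive IsClause {α : Type u'} : ∀ {n : ℕ}, L.BoundedFormula α n → Prop
  | matrix {n} {φ : L.BoundedFormula α n} : IsClauseMatrix φ → IsClause φ
  | all {n} {φ : L.BoundedFormula α (n + 1)} : IsClause φ → IsClause φ.all

/-- A clause set is a conjunction of clauses. -/
inductive IsClauseSet {α : Type u'} : ∀ {n : ℕ}, L.BoundedFormula α n → Prop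
  | clause {n} {φ : L.BoundedFormula α n} : IsClause φ → IsClauseSet φ
  | inf {n} {φ ψ : L.BoundedFormula α n} :
      IsClauseSet φ → IsClauseSet ψ → IsClauseSet (φ ⊓ ψ)

/-- An `∃₁` formula: a quantifier-free formula preceded by a block of
existential quantifiers. -/
inductive IsExistsQF {α : Type u'} : ∀ {n : ℕ}, L.BoundedFormula α n → Prop
  | of_isQF {n} {φ : L.BoundedFormula α n} : φ.IsQF → IsExistsQF φ
  | ex {n} {φ : L.BoundedFormula α (n + 1)} : IsExistsQF φ → IsExistsQF φ.ex

variable (zero : L.Constants) (succ : L.Functions 1)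

/-- The interpretation of the successor symbol in a structure. -/
def sFun {M : Type w} [L.Structure M] (a : M) : M :=
  funMap succ ![a]

/-- The interpretation of the zero symbol in a structure. -/
def zElt (M : Type w) [L.Structure M] : M :=
  funMap zero ![]

/-- The interpretation of the numeral `s^k(0)` in a structure. -/
def numElt (M : Type w) [L.Structure M] (k : ℕ) : M :=
  (sFun succ)^[k] (zElt zero M)

/-- Universal quantification of the distinguished (`Sum.inr`) free variable. -/
def close1 {α : Type u'} (φ : L.Formula (α ⊕ Fin 1)) : L.Formula α :=
  (BoundedFormula.relabel (Sum.elim Sum.inl (fun _ => Sum.inr (0 : Fin 1))) φ).all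

/-- Universal closure of a formula with finitely many free variables. -/
def closeAll {k : ℕ} (φ : L.Formula (Fin k)) : L.Sentence :=
  (BoundedFormula.relabel (fun i => (Sum.inr i : Empty ⊕ Fin k)) φ).alls

/-- The induction axiom `Ind_x ψ` for a formula `ψ(x, z̄)`, where the
induction variable `x` is the `Sum.inr` variable and the parameters
`z̄` are the `Sum.inl` variables:
`∀ z̄ (ψ(0,z̄) → ∀x (ψ(x,z̄) → ψ(s(x),z̄)) → ∀x ψ(x,z̄))`. -/
def indAxiom {k : ℕ} (ψ : L.Formula (Fin k ⊕ Fin 1)) : L.Sentence :=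
  closeAll
    ((ψ.subst (Sum.elim Term.var fun _ => Constants.term zero)).imp
      ((close1 (ψ.imp
          (ψ.subst (Sum.elim (fun i => Term.var (Sum.inl i))
            fun _ => Functions.apply₁ succ (Term.var (Sum.inr 0)))))).imp
        (close1 ψ)))

/-- The theory `I∃₁(L)` of induction for `∃₁` formulas. -/
def IndE1 : L.Theory :=
  { σ | ∃ (k : ℕ) (ψ : L.Formula (Fin k ⊕ Fin 1)), IsExistsQF ψ ∧ σ = indAxiom zero succ ψ }

/-- The theory `IOpen(L)` of induction for quantifier-free formulas. -/
def IOpenTh : L.Theory :=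
  { σ | ∃ (k : ℕ) (ψ : L.Formula (Fin k ⊕ Fin 1)), ψ.IsQF ∧ σ = indAxiom zero succ ψ }

end ClauseSetCycles

namespace ClauseSetCycles

section

open FirstOrder.Language.BoundedFormula

variable {L : FirstOrder.Language.{u, v}} {α : Type u'} {n : ℕ}

theorem IsLiteral.castLE {φ : L.BoundedFormula α n} (h : IsLiteral φ) :
    ∀ {m : ℕ} (hm : n ≤ m), IsLiteral (φ.castLE hm) := by
  intro m hm
  cases h with
  | atom h => exact .atom (h.castLE)
  | negAtom h => exact .negAtom (h.castLE)

theorem IsClauseMatrix.castLE {φ : L.BoundedFormula α n} (h : IsClauseMatrix φ) :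
    ∀ {m : ℕ} (hm : n ≤ m), IsClauseMatrix (φ.castLE hm) := by
  intro m hm
  induction h with
  | lit h => exact .lit (h.castLE hm)
  | sup _ _ ih₁ ih₂ => exact .sup ih₁ ih₂
  | impAtom h _ ih => exact .impAtom h.castLE ih

theorem IsClause.castLE {φ : L.BoundedFormula α n} (h : IsClause φ) :
    ∀ {m : ℕ} (hm : n ≤ m), IsClause (φ.castLE hm) := by
  induction h with
  | matrix h => exact fun hm => .matrix (h.castLE hm)
  | all _ ih => exact fun hm => .all (ih (Nat.add_le_add_right hm 1))

theorem IsClauseMatrix.liftAt {φ : L.BoundedFormula α n} (h : IsClauseMatrix φ) (k m : ℕ) :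
    IsClauseMatrix (φ.liftAt k m) := by
  induction h with
  | lit h =>
    cases h with
    | atom h => exact .lit (.atom h.liftAt)
    | negAtom h => exact .lit (.negAtom h.liftAt)
  | sup _ _ ih₁ ih₂ => exact .sup ih₁ ih₂
  | impAtom h _ ih => exact .impAtom h.liftAt ih

theorem IsClause.liftAt {φ : L.BoundedFormula α n} (h : IsClause φ) (k m : ℕ) :
    IsClause (φ.liftAt k m) := by
  induction h with
  | matrix h => exact .matrix (h.liftAt k m)
  | all _ ih => exact .all (ih.castLE _)

theorem IsAtomic.subst {β : Type*} {φ : L.BoundedFormula α n} (h : φ.IsAtomic)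
    (f : α → L.Term β) : (φ.subst f).IsAtomic := by
  cases h with
  | equal t₁ t₂ => exact .equal _ _
  | rel R ts => exact .rel _ _

theorem IsClauseMatrix.subst {β : Type*} {φ : L.BoundedFormula α n} (h : IsClauseMatrix φ)
    (f : α → L.Term β) : IsClauseMatrix (φ.subst f) := by
  induction h with
  | lit h =>
    cases h with
    | atom h => exact .lit (.atom (IsAtomic.subst h f))
    | negAtom h => exact .lit (.negAtom (IsAtomic.subst h f))
  | sup _ _ ih₁ ih₂ => exact .sup ih₁ ih₂
  | impAtom h _ ih => exact .impAtom (IsAtomic.subst h f) ih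

theorem IsClause.subst {β : Type*} {φ : L.BoundedFormula α n} (h : IsClause φ)
    (f : α → L.Term β) : IsClause (φ.subst f) := by
  induction h with
  | matrix h => exact .matrix (h.subst f)
  | all _ ih => exact .all ih

theorem IsClauseSet.subst {β : Type*} {φ : L.BoundedFormula α n} (h : IsClauseSet φ)
    (f : α → L.Term β) : IsClauseSet (φ.subst f) := by
  induction h with
  | clause h => exact .clause (h.subst f)
  | inf _ _ ih₁ ih₂ => exact .inf ih₁ ih₂

theorem IsClauseMatrix.exists_isClause_sup {φ ψ : L.BoundedFormula α n} (hφ : IsClauseMatrix φ)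
    (hψ : IsClause ψ) : ∃ χ : L.BoundedFormula α n, IsClause χ ∧
      ∀ (M : Type w) [L.Structure M] (v : α → M) (xs : Fin n → M),
        χ.Realize v xs ↔ φ.Realize v xs ∨ ψ.Realize v xs := by
  induction hψ with
  | @matrix n ψ h => exact ⟨φ ⊔ ψ, .matrix (.sup hφ h), fun M _ v xs => realize_sup⟩
  | @all n ψ _ ih =>
    obtain ⟨χ, hχ, hr⟩ := ih (hφ.liftAt 1 n)
    refine ⟨χ.all, .all hχ, fun M _ v xs => ?_⟩
    simp only [realize_all, hr, realize_liftAt_one_self, Fin.snoc_comp_castSucc, forall_or_left]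

/-- The disjunction of two clauses is equivalent to a clause. -/
theorem IsClause.exists_isClause_sup {φ ψ : L.BoundedFormula α n} (hφ : IsClause φ)
    (hψ : IsClause ψ) : ∃ χ : L.BoundedFormula α n, IsClause χ ∧
      ∀ (M : Type w) [L.Structure M] (v : α → M) (xs : Fin n → M),
        χ.Realize v xs ↔ φ.Realize v xs ∨ ψ.Realize v xs := by
  induction hφ with
  | matrix h => exact h.exists_isClause_sup hψ
  | @all n φ _ ih =>
    obtain ⟨χ, hχ, hr⟩ := ih (hψ.liftAt 1 n)
    refine ⟨χ.all, .all hχ, fun M _ v xs => ?_⟩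
    simp only [realize_all, hr, realize_liftAt_one_self, Fin.snoc_comp_castSucc, forall_or_right]

theorem IsClause.exists_isClauseSet_sup {φ ψ : L.BoundedFormula α n} (hφ : IsClause φ)
    (hψ : IsClauseSet ψ) : ∃ χ : L.BoundedFormula α n, IsClauseSet χ ∧
      ∀ (M : Type w) [L.Structure M] (v : α → M) (xs : Fin n → M),
        χ.Realize v xs ↔ φ.Realize v xs ∨ ψ.Realize v xs := by
  induction hψ with
  | clause h =>
    obtain ⟨χ, hχ, hr⟩ := hφ.exists_isClause_sup h
    exact ⟨χ, .clause hχ, hr⟩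
  | inf _ _ ih₁ ih₂ =>
    obtain ⟨χ₁, h₁, hr₁⟩ := ih₁
    obtain ⟨χ₂, h₂, hr₂⟩ := ih₂
    refine ⟨χ₁ ⊓ χ₂, .inf h₁ h₂, fun M _ v xs => ?_⟩
    rw [realize_inf, realize_inf, hr₁, hr₂, or_and_left]

/-- The disjunction of two clause sets is equivalent to a clause set. -/
theorem IsClauseSet.exists_isClauseSet_sup {φ ψ : L.BoundedFormula α n} (hφ : IsClauseSet φ)
    (hψ : IsClauseSet ψ) : ∃ χ : L.BoundedFormula α n, IsClauseSet χ ∧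
      ∀ (M : Type w) [L.Structure M] (v : α → M) (xs : Fin n → M),
        χ.Realize v xs ↔ φ.Realize v xs ∨ ψ.Realize v xs := by
  induction hφ with
  | clause h => exact h.exists_isClauseSet_sup hψ
  | inf _ _ ih₁ ih₂ =>
    obtain ⟨χ₁, h₁, hr₁⟩ := ih₁
    obtain ⟨χ₂, h₂, hr₂⟩ := ih₂
    refine ⟨χ₁ ⊓ χ₂, .inf h₁ h₂, fun M _ v xs => ?_⟩
    rw [realize_inf, realize_inf, hr₁, hr₂, and_or_right]

/-- The term `s^k(η)`. -/
def iterTerm (succ : L.Functions 1) (k : ℕ) : L.Term Unit :=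
  (Functions.apply₁ succ)^[k] (Term.var ())

theorem realize_iterTerm (succ : L.Functions 1) (k : ℕ) {M : Type w} [L.Structure M] (a : M) :
    (iterTerm succ k).realize (fun _ => a) = (sFun succ)^[k] a := by
  induction k with
  | zero => rfl
  | succ k ih =>
    rw [iterTerm, Function.iterate_succ_apply', Function.iterate_succ_apply', ← ih]
    exact Term.realize_functions_apply₁

/-- The clause set `S(s^k(η))`, as a clause set. -/
theorem IsClauseSet.exists_iterate {S : L.Formula Unit} (hS : IsClauseSet S)
    (succ : L.Functions 1) (k : ℕ) : ∃ U : L.Formula Unit, IsClauseSet U ∧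
      ∀ (M : Type w) [L.Structure M] (a : M),
        U.Realize (fun _ => a) ↔ S.Realize (fun _ => (sFun succ)^[k] a) := by
  refine ⟨BoundedFormula.subst S fun _ => iterTerm succ k, hS.subst _, fun M _ a => ?_⟩
  simp only [Formula.Realize, realize_subst, realize_iterTerm]

/-- The disjunction `⋁_{l<j} S(s^{i+l}(η))` is equivalent to a clause set. -/
theorem IsClauseSet.exists_iSup_iterate {S : L.Formula Unit} (hS : IsClauseSet S)
    (succ : L.Functions 1) (i : ℕ) {j : ℕ} (hj : 1 ≤ j) :
    ∃ U : L.Formula Unit, IsClauseSet U ∧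
      ∀ (M : Type w) [L.Structure M] (a : M),
        U.Realize (fun _ => a) ↔ ∃ l < j, S.Realize (fun _ => (sFun succ)^[i + l] a) := by
  induction j, hj using Nat.le_induction with
  | base =>
    obtain ⟨U, hU, hr⟩ := exists_iterate.{u, v, w} hS succ i
    exact ⟨U, hU, fun M _ a => by simp [hr]⟩
  | succ j _ ih =>
    obtain ⟨U, hU, hr⟩ := ih
    obtain ⟨V, hV, hs⟩ := hS.exists_iterate succ (i + j)
    obtain ⟨W, hW, ht⟩ := hU.exists_isClauseSet_sup hV
    refine ⟨W, hW, fun M _ a => ?_⟩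
    rw [Nat.exists_lt_succ_right, ← hr, ← hs]
    exact ht M _ _

end

/-- If a clause set `R(η)` is refuted by a clause set cycle `S(η)` with
offset `i` and step `j` (where `j ≥ 1`), then `R(η)` is refuted by a clause set cycle (with
offset `0` and step `1`); explicitly, there is a clause set `U(η)` which is logically
equivalent to `⋁_{l=0}^{j-1} S(s^{i+l}(η))`, is a clause set cycle, and refutes `R(η)`. -/
theorem statement3 {L : FirstOrder.Language.{u, v}} (zero : L.Constants) (succ : L.Functions 1)
    (R : L.Formula Unit) (hR : IsClauseSet R)
    (S : L.Formula Unit) (hS : IsClauseSet S)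
    (i j : ℕ) (hj : 1 ≤ j)
    -- `S((k+i)‾) ⊨ ⊥` for `k = 0, …, j-1`
    (hcycBase : ∀ k < j, ∀ (M : Type w) [L.Structure M] [Nonempty M],
      ¬ S.Realize (fun _ => numElt zero succ M (k + i)))
    -- `S(s^{i+j}(η)) ⊨ S(s^i(η))`
    (hcycStep : ∀ (M : Type w) [L.Structure M] [Nonempty M] (a : M),
      S.Realize (fun _ => (sFun succ)^[i + j] a) → S.Realize (fun _ => (sFun succ)^[i] a))
    (n : ℕ)
    -- `R(k̄) ⊨ ⊥` for `k = 0, …, n-1`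
    (hrefBase : ∀ k < n, ∀ (M : Type w) [L.Structure M] [Nonempty M],
      ¬ R.Realize (fun _ => numElt zero succ M k))
    -- `R(s^n(η)) ⊨ S(s^i(η))`
    (hrefStep : ∀ (M : Type w) [L.Structure M] [Nonempty M] (a : M),
      R.Realize (fun _ => (sFun succ)^[n] a) → S.Realize (fun _ => (sFun succ)^[i] a)) :
    ∃ U : L.Formula Unit, IsClauseSet U ∧
      -- `U(η)` is logically equivalent to `⋁_{l=0}^{j-1} S(s^{i+l}(η))`
      (∀ (M : Type w) [L.Structure M] [Nonempty M] (a : M),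
        U.Realize (fun _ => a) ↔ ∃ l < j, S.Realize (fun _ => (sFun succ)^[i + l] a)) ∧
      -- `U(0) ⊨ ⊥`
      (∀ (M : Type w) [L.Structure M] [Nonempty M],
        ¬ U.Realize (fun _ => zElt zero M)) ∧
      -- `U(s(η)) ⊨ U(η)`
      (∀ (M : Type w) [L.Structure M] [Nonempty M] (a : M),
        U.Realize (fun _ => sFun succ a) → U.Realize (fun _ => a)) ∧
      -- `R` is refuted by the clause set cycle `U`
      ∃ m : ℕ,
        (∀ (M : Type w) [L.Structure M] [Nonempty M] (a : M),
          R.Realize (fun _ => (sFun succ)^[m] a) → U.Realize (fun _ => a)) ∧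
        ∀ k < m, ∀ (M : Type w) [L.Structure M] [Nonempty M],
          ¬ R.Realize (fun _ => numElt zero succ M k) := by
  obtain ⟨U, hU, hr⟩ := hS.exists_iSup_iterate succ i hj
  refine ⟨U, hU, fun M _ _ a => hr M a, fun M _ _ h => ?_, fun M _ _ a h => ?_,
    n, fun M _ _ a h => ?_, hrefBase⟩
  · obtain ⟨l, hl, h⟩ := (hr M _).1 h
    rw [Nat.add_comm] at h
    exact hcycBase l hl M h
  · obtain ⟨l, hl, h⟩ := (hr M _).1 h
    simp only [← Function.iterate_succ_apply] at h
    rcases Nat.lt_or_ge (l + 1) j with hlt | hge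
    · exact (hr M a).2 ⟨l + 1, hlt, h⟩
    · obtain rfl : j = l + 1 := by omega
      exact (hr M a).2 ⟨0, hj, hcycStep M a h⟩
  · exact (hr M a).2 ⟨0, hj, hrefStep M a h⟩

end ClauseSetCycles
end

section
/- The theory T_▷ + IOpen(L_▷) does not prove ∀x ∃y x ▷ y; equivalently, there exists a model of T_▷ + IOpen(L_▷) in which the triangle relation ▷ is not total. -/
open FirstOrder Language Structure

universe u v u'

namespace TriangularNumbers

/-- The function symbols of the language `L_▷`: `0`, `s`, `p`, `+`. -/
inductive TriFunc : ℕ → Type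
  | zero : TriFunc 0
  | succ : TriFunc 1
  | pred : TriFunc 1
  | plus : TriFunc 2

/-- The relation symbols of the language `L_▷`: the binary symbol `▷`. -/
inductive TriRel : ℕ → Type
  | tri : TriRel 2

/-- The language `L_▷` with function symbols `0`, `s`, `p`, `+` and a binary
predicate symbol `▷`. -/
def LTri : FirstOrder.Language := ⟨TriFunc, TriRel⟩

def fZero : LTri.Constants := TriFunc.zero
def fSucc : LTri.Functions 1 := TriFunc.succ
def fPred : LTri.Functions 1 := TriFunc.pred
def fPlus : LTri.Functions 2 := TriFunc.plus
def rTri : LTri.Relations 2 := TriRel.tri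

/-- The term `0`. -/
def zT {α : Type u'} : LTri.Term α := Constants.term fZero
/-- The term `s(t)`. -/
def sT {α : Type u'} (t : LTri.Term α) : LTri.Term α := Functions.apply₁ fSucc t
/-- The term `p(t)`. -/
def pT {α : Type u'} (t : LTri.Term α) : LTri.Term α := Functions.apply₁ fPred t
/-- The term `t + u`. -/
def aT {α : Type u'} (t u : LTri.Term α) : LTri.Term α := Functions.apply₂ fPlus t u

/-- (A1) `∀x s(x) ≠ 0`. -/
def axA1 : LTri.Sentence := ∀' ∼(sT &0 =' zT)
/-- (A2) `p(0) = 0`. -/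
def axA2 : LTri.Sentence := pT zT =' zT
/-- (A3) `∀x p(s(x)) = x`. -/
def axA3 : LTri.Sentence := ∀' (pT (sT &0) =' &0)
/-- (A4) `∀x x + 0 = x`. -/
def axA4 : LTri.Sentence := ∀' (aT &0 zT =' &0)
/-- (A5) `∀x∀y x + s(y) = s(x + y)`. -/
def axA5 : LTri.Sentence := ∀' ∀' (aT &0 (sT &1) =' sT (aT &0 &1))
/-- (A6) `0 ▷ 0`. -/
def axA6 : LTri.Sentence := rTri.boundedFormula₂ zT zT
/-- (A7) `∀x∀y (x ▷ y → s(x) ▷ s(x) + y)`. -/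
def axA7 : LTri.Sentence :=
  ∀' ∀' (rTri.boundedFormula₂ &0 &1 ⟹ rTri.boundedFormula₂ (sT &0) (aT (sT &0) &1))
/-- (A8) `∀x∀y (s(x) ▷ s(x) + y → x ▷ y)`. -/
def axA8 : LTri.Sentence :=
  ∀' ∀' (rTri.boundedFormula₂ (sT &0) (aT (sT &0) &1) ⟹ rTri.boundedFormula₂ &0 &1)
/-- (A9) `∀x∀y∀z (x ▷ y ∧ x ▷ z → y = z)`. -/
def axA9 : LTri.Sentence :=
  ∀' ∀' ∀' ((rTri.boundedFormula₂ &0 &1 ⊓ rTri.boundedFormula₂ &0 &2) ⟹ (&1 =' &2))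

/-- The theory `T_▷`, axiomatized by (A1)–(A9). -/
def TTri : LTri.Theory := {axA1, axA2, axA3, axA4, axA5, axA6, axA7, axA8, axA9}

/-- (B1) `∀x (x ≠ 0 → x = s(p(x)))`. -/
def axB1 : LTri.Sentence := ∀' (∼(&0 =' zT) ⟹ (&0 =' sT (pT &0)))
/-- (B2) `∀x∀y x + y = y + x`. -/
def axB2 : LTri.Sentence := ∀' ∀' (aT &0 &1 =' aT &1 &0)
/-- (B3) `∀x∀y∀z (x+y)+z = x+(y+z)`. -/
def axB3 : LTri.Sentence := ∀' ∀' ∀' (aT (aT &0 &1) &2 =' aT &0 (aT &1 &2))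
/-- (B4) `∀x∀y∀z (x+y = x+z → y = z)`. -/
def axB4 : LTri.Sentence := ∀' ∀' ∀' ((aT &0 &1 =' aT &0 &2) ⟹ (&1 =' &2))

/-- The theory `T_▷^I = T_▷ + B1 + B2 + B3 + B4`. -/
def TTriI : LTri.Theory := TTri ∪ {axB1, axB2, axB3, axB4}

end TriangularNumbers

namespace TriangularNumbers

/-- Universal quantification of the distinguished (`Sum.inr`) free variable. -/
def close1 {L : FirstOrder.Language.{u, v}} {α : Type u'} (φ : L.Formula (α ⊕ Fin 1)) :
    L.Formula α :=
  (BoundedFormula.relabel (Sum.elim Sum.inl (fun _ => Sum.inr (0 : Fin 1))) φ).all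

/-- Universal closure of a formula with finitely many free variables. -/
def closeAll {L : FirstOrder.Language.{u, v}} {k : ℕ} (φ : L.Formula (Fin k)) : L.Sentence :=
  (BoundedFormula.relabel (fun i => (Sum.inr i : Empty ⊕ Fin k)) φ).alls

/-- The induction axiom `Ind_x ψ` for a formula `ψ(x, z̄)`, where the induction variable `x`
is the `Sum.inr` variable and the parameters `z̄` are the `Sum.inl` variables:
`∀ z̄ (ψ(0,z̄) → ∀x (ψ(x,z̄) → ψ(s(x),z̄)) → ∀x ψ(x,z̄))`. -/
def indAxiom {L : FirstOrder.Language.{u, v}} (zero : L.Constants) (succ : L.Functions 1)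
    {k : ℕ} (ψ : L.Formula (Fin k ⊕ Fin 1)) : L.Sentence :=
  closeAll
    ((ψ.subst (Sum.elim Term.var fun _ => Constants.term zero)).imp
      ((close1 (ψ.imp
          (ψ.subst (Sum.elim (fun i => Term.var (Sum.inl i))
            fun _ => Functions.apply₁ succ (Term.var (Sum.inr 0)))))).imp
        (close1 ψ)))

/-- The theory `IOpen(L)` of induction for quantifier-free formulas. -/
def IOpenTh {L : FirstOrder.Language.{u, v}} (zero : L.Constants) (succ : L.Functions 1) :
    L.Theory :=
  { σ | ∃ (k : ℕ) (ψ : L.Formula (Fin k ⊕ Fin 1)), ψ.IsQF ∧ σ = indAxiom zero succ ψ }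

end TriangularNumbers

namespace TriangularNumbers

/-- The sentence `∀x ∃y x ▷ y` expressing that the triangle relation is total. -/
def totalTri : LTri.Sentence := ∀' ∃' (rTri.boundedFormula₂ &0 &1)

/-- The nonnegative cone of `ℤ × ℤ` in the lexicographic order; the elements with vanishing
first coordinate are the standard ones. -/
def LexCone : Type := {x : ℤ × ℤ // 0 ≤ x.1 ∧ (x.1 = 0 → 0 ≤ x.2)}

namespace LexCone

@[ext] theorem ext {x y : LexCone} (h₁ : x.1.1 = y.1.1) (h₂ : x.1.2 = y.1.2) : x = y :=
  Subtype.ext (Prod.ext h₁ h₂)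

def zero : LexCone := ⟨(0, 0), by simp⟩

def succ (x : LexCone) : LexCone :=
  ⟨(x.1.1, x.1.2 + 1), x.2.1, fun h => by have := x.2.2 h; dsimp only; omega⟩

open Classical in
noncomputable def pred (x : LexCone) : LexCone :=
  if h : x = zero then zero else
    ⟨(x.1.1, x.1.2 - 1), x.2.1, fun h₁ => by
      have h₂ := x.2.2 h₁
      have h₃ : x.1.2 ≠ 0 := fun h₃ => h (ext h₁ h₃)
      dsimp only; omega⟩

def add (x y : LexCone) : LexCone :=
  ⟨(x.1.1 + y.1.1, x.1.2 + y.1.2), add_nonneg x.2.1 y.2.1, fun h => by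
    have hx := x.2.1
    have hy := y.2.1
    have := x.2.2 (by dsimp only at h; omega)
    have := y.2.2 (by dsimp only at h; omega)
    dsimp only; omega⟩

/-- The graph of the triangle function on the standard elements. -/
def Tri (x y : LexCone) : Prop :=
  x.1.1 = 0 ∧ y.1.1 = 0 ∧ 2 * y.1.2 = x.1.2 * (x.1.2 + 1)

/-- The standard elements. -/
def ofNat (k : ℕ) : LexCone := ⟨(0, k), by simp⟩

/-- Subtraction of a natural number from a nonstandard element. -/
def subNat (c : LexCone) (hc : 0 < c.1.1) (k : ℕ) : LexCone :=
  ⟨(c.1.1, c.1.2 - k), hc.le, fun h => absurd h hc.ne'⟩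

/-- The filter generated by the tails of the standard elements and by the tails of the
predecessors of `c`. -/
def tails (c : LexCone) (hc : 0 < c.1.1) : Filter LexCone :=
  Filter.map ofNat Filter.atTop ⊔ Filter.map (c.subNat hc) Filter.atTop

theorem eventually_tails {c : LexCone} {hc : 0 < c.1.1} {P : LexCone → Prop} :
    (∀ᶠ x in tails c hc, P x) ↔
      (∀ᶠ k in Filter.atTop, P (ofNat k)) ∧ ∀ᶠ k in Filter.atTop, P (c.subNat hc k) := by
  simp [tails, Filter.eventually_sup, Filter.eventually_map]

theorem tails_le_cofinite (c : LexCone) (hc : 0 < c.1.1) : tails c hc ≤ Filter.cofinite := by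
  have h₁ : Function.Injective ofNat := fun i j h => by
    have := congrArg (fun x : LexCone => x.1.2) h
    simpa [ofNat] using this
  have h₂ : Function.Injective (c.subNat hc) := fun i j h => by
    have := congrArg (fun x : LexCone => x.1.2) h
    simpa [subNat] using this
  refine sup_le ?_ ?_
  · have := h₁.tendsto_cofinite
    rwa [Nat.cofinite_eq_atTop] at this
  · have := h₂.tendsto_cofinite
    rwa [Nat.cofinite_eq_atTop] at this

theorem eventually_not_of_subsingleton {c : LexCone} {hc : 0 < c.1.1} {P : LexCone → Prop}
    (h : ∀ x y, P x → P y → x = y) : ∀ᶠ x in tails c hc, ¬ P x := by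
  apply tails_le_cofinite c hc
  have : {x | P x}.Subsingleton := fun x hx y hy => h x y hx hy
  simpa [Filter.mem_cofinite, Set.compl_ofPred] using this.finite

/-- Along the filter, the function `f` agrees with the affine function `x ↦ n x + (a, b)`. -/
def EventuallyAffine (l : Filter LexCone) (f : LexCone → LexCone) (n : ℕ) (a b : ℤ) : Prop :=
  ∀ᶠ x in l, (f x).1.1 = n * x.1.1 + a ∧ (f x).1.2 = n * x.1.2 + b

theorem EventuallyAffine.nonneg {c : LexCone} {hc : 0 < c.1.1} {f : LexCone → LexCone} {n : ℕ}
    {a b : ℤ} (h : EventuallyAffine (tails c hc) f n a b) : 0 ≤ a := by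
  obtain ⟨k, hk⟩ := (eventually_tails.1 h).1.exists
  have := (f (ofNat k)).2.1
  simp [ofNat] at hk this
  omega

/-- A property that is eventually true or eventually false along a filter. -/
def Decided (l : Filter LexCone) (P : LexCone → Prop) : Prop :=
  (∀ᶠ x in l, P x) ∨ ∀ᶠ x in l, ¬ P x

theorem affine_injective {m n : ℕ} (h : m ≠ n) {a b a' b' : ℤ} {x y : LexCone}
    (hx₁ : (m : ℤ) * x.1.1 + a = n * x.1.1 + a') (hx₂ : (m : ℤ) * x.1.2 + b = n * x.1.2 + b')
    (hy₁ : (m : ℤ) * y.1.1 + a = n * y.1.1 + a') (hy₂ : (m : ℤ) * y.1.2 + b = n * y.1.2 + b') :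
    x = y := by
  have hd : (m : ℤ) - n ≠ 0 := by omega
  apply ext
  · apply mul_left_cancel₀ hd; linarith
  · apply mul_left_cancel₀ hd; linarith

theorem EventuallyAffine.decided_eq {c : LexCone} {hc : 0 < c.1.1} {f g : LexCone → LexCone}
    {m n : ℕ} {a b a' b' : ℤ} (hf : EventuallyAffine (tails c hc) f m a b)
    (hg : EventuallyAffine (tails c hc) g n a' b') :
    Decided (tails c hc) fun x => f x = g x := by
  by_cases hmn : m = n
  · subst hmn
    by_cases hab : a = a' ∧ b = b'
    · left
      filter_upwards [hf, hg] with x hx hy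
      apply ext
      · rw [hx.1, hy.1, hab.1]
      · rw [hx.2, hy.2, hab.2]
    · right
      filter_upwards [hf, hg] with x hx hy h
      rw [h] at hx
      exact hab ⟨by linarith [hx.1, hy.1], by linarith [hx.2, hy.2]⟩
  · right
    filter_upwards [hf, hg, eventually_not_of_subsingleton (c := c) (hc := hc)
      (P := fun x => (m : ℤ) * x.1.1 + a = n * x.1.1 + a' ∧
        (m : ℤ) * x.1.2 + b = n * x.1.2 + b')
      (fun x y hx hy => affine_injective hmn hx.1 hx.2 hy.1 hy.2)] with x hx hy hne h
    rw [h] at hx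
    exact hne ⟨by linarith [hx.1, hy.1], by linarith [hx.2, hy.2]⟩

theorem EventuallyAffine.pred {c : LexCone} {hc : 0 < c.1.1} {f : LexCone → LexCone} {n : ℕ}
    {a b : ℤ} (hf : EventuallyAffine (tails c hc) f n a b) :
    ∃ n' a' b', EventuallyAffine (tails c hc) (fun x => (f x).pred) n' a' b' := by
  have h₀ : EventuallyAffine (tails c hc) (fun _ => zero) 0 0 0 := by
    simp [EventuallyAffine, zero]
  rcases hf.decided_eq h₀ with h | h
  · refine ⟨0, 0, 0, ?_⟩
    filter_upwards [h] with x hx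
    have : (f x).pred = zero := dif_pos hx
    simp [this, zero]
  · refine ⟨n, a, b - 1, ?_⟩
    filter_upwards [h, hf] with x hx hy
    have h₁ : (f x).pred.1 = ((f x).1.1, (f x).1.2 - 1) :=
      congrArg Subtype.val (dif_neg hx)
    rw [h₁, hy.1, hy.2]
    exact ⟨rfl, by ring⟩

theorem quadratic_ne {m n : ℕ} (hm : 0 < m) (b b' : ℤ) :
    ∀ᶠ k : ℕ in Filter.atTop,
      2 * ((n : ℤ) * k + b') ≠ (m * k + b) * (m * k + b + 1) := by
  filter_upwards [Filter.eventually_ge_atTop (2 * b.natAbs + 8 * n + 8 * b'.natAbs + 1)]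
    with k hk
  have hm' : (1 : ℤ) ≤ m := by exact_mod_cast hm
  have hk₀ : (0 : ℤ) ≤ k := by positivity
  have h₁ : (k : ℤ) ≤ m * k := by nlinarith
  have h₂ : (k : ℤ) ≤ 2 * (m * k + b) := by omega
  have h₃ : (k : ℤ) * k ≤ (2 * (m * k + b)) * (2 * (m * k + b)) :=
    mul_le_mul h₂ h₂ hk₀ (by omega)
  have h₄ : (8 * n + 8 * b'.natAbs + 1) * (k : ℤ) ≤ k * k :=
    mul_le_mul_of_nonneg_right (by omega) hk₀
  have h₅ : (b'.natAbs : ℤ) ≤ b'.natAbs * (k : ℤ) :=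
    le_mul_of_one_le_right (by positivity) (by omega)
  have h₆ : b' ≤ b'.natAbs := by omega
  have h₇ : (1 : ℤ) ≤ k := by omega
  nlinarith

theorem EventuallyAffine.decided_tri {c : LexCone} {hc : 0 < c.1.1} {f g : LexCone → LexCone}
    {m n : ℕ} {a b a' b' : ℤ} (hf : EventuallyAffine (tails c hc) f m a b)
    (hg : EventuallyAffine (tails c hc) g n a' b') :
    Decided (tails c hc) fun x => Tri (f x) (g x) := by
  have ha := hf.nonneg
  rcases Nat.eq_zero_or_pos m with rfl | hm
  · rcases Nat.eq_zero_or_pos n with rfl | hn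
    · by_cases h : a = 0 ∧ a' = 0 ∧ 2 * b' = b * (b + 1)
      · left
        filter_upwards [hf, hg] with x hx hy
        simpa [Tri, hx, hy] using h
      · right
        filter_upwards [hf, hg] with x hx hy
        simpa [Tri, hx, hy] using h
    · right
      have hn' : (n : ℤ) ≠ 0 := by omega
      filter_upwards [hf, hg, eventually_not_of_subsingleton (c := c) (hc := hc)
        (P := fun x => (n : ℤ) * x.1.1 + a' = 0 ∧ 2 * (n * x.1.2 + b') = b * (b + 1))
        (fun x y hx hy => ext (mul_left_cancel₀ hn' (by linarith [hx.1, hy.1]))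
          (mul_left_cancel₀ hn' (by linarith [hx.2, hy.2])))] with x hx hy hne h
      simp [Tri, hx, hy] at h
      exact hne h.2
  · right
    obtain ⟨hf₁, hf₂⟩ := eventually_tails.1 hf
    obtain ⟨hg₁, -⟩ := eventually_tails.1 hg
    refine eventually_tails.2 ⟨?_, ?_⟩
    · filter_upwards [hf₁, hg₁, quadratic_ne (n := n) hm b b'] with k hx hy hne h
      apply hne
      have := h.2.2
      rw [hx.2, hy.2] at this
      simpa [ofNat] using this
    · filter_upwards [hf₂] with k hx h
      have h₁ := h.1
      rw [hx.1] at h₁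
      have : 0 < (m : ℤ) * c.1.1 := mul_pos (by exact_mod_cast hm) hc
      simp only [subNat] at h₁
      omega

noncomputable instance : LTri.Structure LexCone where
  funMap {_} f v := match f, v with
    | TriFunc.zero, _ => zero
    | TriFunc.succ, v => (v 0).succ
    | TriFunc.pred, v => (v 0).pred
    | TriFunc.plus, v => (v 0).add (v 1)
  RelMap {_} r v := match r, v with
    | TriRel.tri, v => Tri (v 0) (v 1)

theorem exists_eventuallyAffine_realize {c : LexCone} {hc : 0 < c.1.1} {β : Type*}
    {e : LexCone → β → LexCone} (he : ∀ i, (∀ x, e x i = x) ∨ ∃ d, ∀ x, e x i = d)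
    (t : LTri.Term β) :
    ∃ n a b, EventuallyAffine (tails c hc) (fun x => t.realize (e x)) n a b := by
  induction t with
  | var i =>
    rcases he i with h | ⟨d, h⟩
    · exact ⟨1, 0, 0, by simp [EventuallyAffine, h]⟩
    · exact ⟨0, d.1.1, d.1.2, by simp [EventuallyAffine, h]⟩
  | @func l f ts ih =>
    cases f with
    | zero => exact ⟨0, 0, 0, Filter.Eventually.of_forall fun x => by
        simp [Term.realize, funMap, zero]⟩
    | succ =>
      obtain ⟨n, a, b, h⟩ := ih 0
      refine ⟨n, a, b + 1, ?_⟩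
      filter_upwards [h] with x hx
      simp only [Term.realize, funMap, succ, hx]
      exact ⟨trivial, by ring⟩
    | pred =>
      obtain ⟨n, a, b, h⟩ := ih 0
      exact h.pred
    | plus =>
      obtain ⟨n, a, b, h⟩ := ih 0
      obtain ⟨n', a', b', h'⟩ := ih 1
      refine ⟨n + n', a + a', b + b', ?_⟩
      filter_upwards [h, h'] with x hx hy
      simp only [Term.realize, funMap, add, hx, hy]
      push_cast
      exact ⟨by ring, by ring⟩

theorem decided_realize {c : LexCone} {hc : 0 < c.1.1} {β : Type*} {m : ℕ}
    {e : LexCone → β → LexCone} {w : Fin m → LexCone}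
    (he : ∀ i, (∀ x, e x i = x) ∨ ∃ d, ∀ x, e x i = d)
    {φ : LTri.BoundedFormula β m} (hφ : φ.IsQF) :
    Decided (tails c hc) fun x => φ.Realize (e x) w := by
  have he' : ∀ i, (∀ x, Sum.elim (e x) w i = x) ∨ ∃ d, ∀ x, Sum.elim (e x) w i = d := by
    rintro (i | i)
    · simpa using he i
    · exact Or.inr ⟨w i, fun x => rfl⟩
  induction hφ with
  | falsum => exact Or.inr (Filter.Eventually.of_forall fun x h => h)
  | of_isAtomic h =>
    cases h with
    | equal t₁ t₂ =>
      obtain ⟨n, a, b, h⟩ := exists_eventuallyAffine_realize (c := c) (hc := hc) he' t₁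
      obtain ⟨n', a', b', h'⟩ := exists_eventuallyAffine_realize (c := c) (hc := hc) he' t₂
      simpa using h.decided_eq h'
    | rel R ts =>
      cases R with
      | tri =>
        obtain ⟨n, a, b, h⟩ := exists_eventuallyAffine_realize (c := c) (hc := hc) he' (ts 0)
        obtain ⟨n', a', b', h'⟩ := exists_eventuallyAffine_realize (c := c) (hc := hc) he' (ts 1)
        exact h.decided_tri h'
  | imp _ _ ih₁ ih₂ =>
    rcases ih₂ with h₂ | h₂
    · left
      filter_upwards [h₂] with x hx _ using hx
    · rcases ih₁ with h₁ | h₁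
      · right
        filter_upwards [h₁, h₂] with x hx hy h using hy (h hx)
      · left
        filter_upwards [h₁] with x hx h using absurd h hx

theorem induction_of_decided {P : LexCone → Prop} (hP : ∀ c hc, Decided (tails c hc) P)
    (h0 : P zero) (hs : ∀ x, P x → P x.succ) (c : LexCone) : P c := by
  have hstd : ∀ k, P (ofNat k) := by
    intro k
    induction k with
    | zero => exact h0
    | succ k ih => simpa [succ, ofNat] using hs _ ih
  rcases c.2.1.eq_or_lt with h | hc
  · have h₂ := c.2.2 h.symm
    have : c = ofNat c.1.2.toNat := ext h.symm (by simp [ofNat, h₂])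
    rw [this]
    exact hstd _
  · have hdown : ∀ k, P (c.subNat hc k) → P c := by
      intro k
      induction k with
      | zero =>
        intro h
        convert h using 1
        apply ext <;> simp [subNat]
      | succ k ih =>
        intro h
        apply ih
        convert hs _ h using 1
        apply ext
        · simp [subNat, succ]
        · simp only [subNat, succ]
          push_cast
          ring
    rcases hP c hc with h | h
    · obtain ⟨k, hk⟩ := (eventually_tails.1 h).2.exists
      exact hdown k hk
    · obtain ⟨k, hk⟩ := (eventually_tails.1 h).1.exists
      exact absurd (hstd k) hk

end LexCone

theorem realize_close1 {L : FirstOrder.Language.{u, v}} {M : Type*} [L.Structure M]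
    {α : Type u'} (φ : L.Formula (α ⊕ Fin 1)) (z : α → M) :
    (close1 φ).Realize z ↔ ∀ x : M, φ.Realize (Sum.elim z fun _ => x) := by
  rw [close1, Formula.Realize, BoundedFormula.realize_all]
  refine forall_congr' fun x => ?_
  rw [BoundedFormula.realize_relabel, Formula.Realize]
  have h : Sum.elim z (Fin.snoc (default : Fin 0 → M) x ∘ Fin.castAdd 0) ∘
      Sum.elim Sum.inl (fun _ => Sum.inr (0 : Fin 1)) = Sum.elim z fun _ : Fin 1 => x := by
    funext i
    rcases i with i | i
    · rfl
    · simp [Fin.snoc]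
  rw [← h]
  exact iff_of_eq (congrArg _ (Subsingleton.elim _ _))

theorem realize_closeAll {L : FirstOrder.Language.{u, v}} {M : Type*} [L.Structure M]
    {k : ℕ} (φ : L.Formula (Fin k)) :
    M ⊨ closeAll φ ↔ ∀ z : Fin k → M, φ.Realize z := by
  refine BoundedFormula.realize_alls.trans ?_
  exact forall_congr' fun z => Formula.realize_relabel_sumInr φ

theorem realize_indAxiom {L : FirstOrder.Language.{u, v}} {M : Type*} [L.Structure M]
    (zero : L.Constants) (succ : L.Functions 1) {k : ℕ} (ψ : L.Formula (Fin k ⊕ Fin 1)) :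
    M ⊨ indAxiom zero succ ψ ↔ ∀ z : Fin k → M,
      ψ.Realize (Sum.elim z fun _ => (zero : M)) →
      (∀ x : M, ψ.Realize (Sum.elim z fun _ => x) →
        ψ.Realize (Sum.elim z fun _ => funMap succ ![x])) →
      ∀ x : M, ψ.Realize (Sum.elim z fun _ => x) := by
  rw [indAxiom, realize_closeAll]
  refine forall_congr' fun z => ?_
  have h₀ : Formula.Realize (ψ.subst (Sum.elim Term.var fun _ => Constants.term zero)) z ↔
      ψ.Realize (Sum.elim z fun _ => (zero : M)) := by
    rw [Formula.Realize, BoundedFormula.realize_subst, Formula.Realize]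
    refine iff_of_eq (congrArg (fun w => BoundedFormula.Realize ψ w default) ?_)
    funext i
    rcases i with i | i <;> simp
  have h₁ (x : M) : Formula.Realize (ψ.subst (Sum.elim (fun i => Term.var (Sum.inl i))
      fun _ => Functions.apply₁ succ (Term.var (Sum.inr 0)))) (Sum.elim z fun _ : Fin 1 => x) ↔
      ψ.Realize (Sum.elim z fun _ => funMap succ ![x]) := by
    rw [Formula.Realize, BoundedFormula.realize_subst, Formula.Realize]
    refine iff_of_eq (congrArg (fun w => BoundedFormula.Realize ψ w default) ?_)
    funext i
    rcases i with i | i <;> simp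
  rw [Formula.realize_imp, Formula.realize_imp, h₀, realize_close1, realize_close1]
  simp only [Formula.realize_imp, h₁]

namespace LexCone

section Realize

variable {α : Type*} (v : α → LexCone) (t t' : LTri.Term α)

theorem realize_zT : (zT : LTri.Term α).realize v = zero := rfl

theorem realize_sT : (sT t).realize v = (t.realize v).succ := rfl

theorem realize_pT : (pT t).realize v = (t.realize v).pred := rfl

theorem realize_aT : (aT t t').realize v = (t.realize v).add (t'.realize v) := rfl

end Realize

theorem relMap_rTri (w : Fin 2 → LexCone) : RelMap rTri w ↔ Tri (w 0) (w 1) := Iff.rfl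

theorem zero_val : zero.1 = (0, 0) := rfl

theorem succ_val (x : LexCone) : x.succ.1 = (x.1.1, x.1.2 + 1) := rfl

theorem add_val (x y : LexCone) : (x.add y).1 = (x.1.1 + y.1.1, x.1.2 + y.1.2) := rfl

theorem succ_ne_zero (x : LexCone) : x.succ ≠ zero := fun h => by
  have h' := congrArg Subtype.val h
  simp only [succ_val, zero_val, Prod.mk.injEq] at h'
  have := x.2.2 h'.1
  omega

theorem pred_succ (x : LexCone) : x.succ.pred = x := by
  apply ext <;> simp [pred, succ_ne_zero, succ_val]

theorem models_TTri : LexCone ⊨ TTri := by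
  rw [Theory.model_iff]
  intro φ hφ
  simp only [TTri, Set.mem_insert_iff, Set.mem_singleton_iff] at hφ
  rcases hφ with rfl | rfl | rfl | rfl | rfl | rfl | rfl | rfl | rfl <;>
    simp only [axA1, axA2, axA3, axA4, axA5, axA6, axA7, axA8, axA9, Sentence.Realize,
      Formula.Realize, BoundedFormula.realize_all, BoundedFormula.realize_not,
      BoundedFormula.realize_bdEqual, BoundedFormula.realize_imp, BoundedFormula.realize_inf,
      BoundedFormula.realize_rel₂, realize_zT, realize_sT, realize_pT, realize_aT, relMap_rTri,
      Term.realize_var, Sum.elim_inr, Function.comp_apply, Matrix.cons_val_zero,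
      Matrix.cons_val_one]
  · exact fun x => succ_ne_zero _
  · simp [pred]
  · exact fun x => pred_succ _
  · intro x
    apply ext <;> simp [add_val, zero_val]
  · intro x y
    apply ext <;> simp [add_val, succ_val, add_assoc]
  · simp [Tri, zero_val]
  · rintro x y ⟨h₁, h₂, h₃⟩
    simp only [Tri, add_val, succ_val]
    exact ⟨h₁, by omega, by linarith⟩
  · rintro x y ⟨h₁, h₂, h₃⟩
    simp only [add_val, succ_val] at h₁ h₂ h₃
    exact ⟨h₁, by omega, by linarith⟩
  · rintro x y z ⟨⟨-, h₂, h₃⟩, -, h₅, h₆⟩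
    exact ext (by omega) (by omega)

theorem models_IOpenTh : LexCone ⊨ IOpenTh fZero fSucc := by
  rw [Theory.model_iff]
  rintro _ ⟨k, ψ, hψ, rfl⟩
  rw [realize_indAxiom]
  intro z h0 hs
  refine induction_of_decided (P := fun x => ψ.Realize (Sum.elim z fun _ => x)) ?_ h0 hs
  intro c hc
  refine decided_realize ?_ hψ
  rintro (i | i)
  · exact Or.inr ⟨z i, fun x => rfl⟩
  · exact Or.inl fun x => rfl

end LexCone

/-- The theory `T_▷ + IOpen(L_▷)` does not prove `∀x ∃y x ▷ y`;
equivalently, there is a model of `T_▷ + IOpen(L_▷)` in which the triangle relation `▷`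
is not total. -/
theorem statement15 : ¬ (TTri ∪ IOpenTh fZero fSucc) ⊨ᵇ totalTri := by
  intro h
  have hM : LexCone ⊨ TTri ∪ IOpenTh fZero fSucc :=
    Theory.model_union_iff.2 ⟨LexCone.models_TTri, LexCone.models_IOpenTh⟩
  have : Nonempty LexCone := ⟨LexCone.zero⟩
  have ht : LexCone ⊨ totalTri := h.realize_sentence LexCone
  have ht' := ht ⟨(1, 0), by simp⟩
  simp only [BoundedFormula.realize_ex, BoundedFormula.realize_rel₂, LexCone.relMap_rTri] at ht'
  obtain ⟨y, hy, -⟩ := ht'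
  exact one_ne_zero hy

end TriangularNumbers
end
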